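/- Let Σ be a binding signature, M : NomTrm a nameful term and ρ : 𝔸 → 𝔸 a function that is injective on the support of M (i.e. for all x, y ∈ supp M, ρ x = ρ y implies x = y). Then the translation commutes with renaming: ⟦ρ * M⟧ = ρ * ⟦M⟧. -/

import Mathlib

/- A Plotkin-style binding signature: operators with arities. -/
structure Sig where
  Op : Type
  ar : Op → List ℕ

/- Well-scoped locally nameless terms and argument lists over a signature.
Atoms are natural numbers. -/
mutual
inductive Trm (S : Sig) : ℕ → Type where
  | idx : {n : ℕ} → Fin n → Trm S n
  | atm : {n : ℕ} → ℕ → Trm S n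
  | op  : {n : ℕ} → (o : S.Op) → Args S n (S.ar o) → Trm S n
inductive Args (S : Sig) : ℕ → List ℕ → Type where
  | nil : {n : ℕ} → Args S n []
  | cons : {n m : ℕ} → {ms : List ℕ} → Trm S (m + n) → Args S n ms → Args S n (m :: ms)
end

variable {S : Sig}

/- Scope weakening. -/
mutual
def Trm.weaken : {m n : ℕ} → m ≤ n → Trm S m → Trm S n
  | _, _, h, .idx i => .idx (Fin.castLE h i)
  | _, _, _, .atm x => .atm x
  | _, _, h, .op o as => .op o (Args.weaken h as)
def Args.weaken : {m n : ℕ} → {ms : List ℕ} → m ≤ n → Args S m ms → Args S n ms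
  | _, _, _, _, .nil => .nil
  | _, _, _, h, .cons t ts => .cons (Trm.weaken (Nat.add_le_add_left h _) t) (Args.weaken h ts)
end

/- Support: the finite set of atoms occurring in a term. -/
mutual
def Trm.supp : {n : ℕ} → Trm S n → Finset ℕ
  | _, .idx _ => ∅
  | _, .atm x => {x}
  | _, .op _ as => Args.supp as
def Args.supp : {n : ℕ} → {ms : List ℕ} → Args S n ms → Finset ℕ
  | _, _, .nil => ∅
  | _, _, .cons t ts => Trm.supp t ∪ Args.supp ts
end

/- Action of a substitution σ : 𝔸 → Trm on terms. -/
mutual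
def Trm.subst (σ : ℕ → Trm S 0) : {n : ℕ} → Trm S n → Trm S n
  | _, .idx i => .idx i
  | n, .atm x => Trm.weaken (Nat.zero_le n) (σ x)
  | _, .op o as => .op o (Args.subst σ as)
def Args.subst (σ : ℕ → Trm S 0) : {n : ℕ} → {ms : List ℕ} → Args S n ms → Args S n ms
  | _, _, .nil => .nil
  | _, _, .cons t ts => .cons (Trm.subst σ t) (Args.subst σ ts)
end

/- The single substitution (x := u). -/
def single (x : ℕ) (u : Trm S 0) : ℕ → Trm S 0 := fun y => if x = y then u else .atm y

/- Renaming a term along ρ : 𝔸 → 𝔸, i.e. substitution along 𝐚 ∘ ρ. -/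
def Trm.rename (ρ : ℕ → ℕ) {n : ℕ} (t : Trm S n) : Trm S n :=
  Trm.subst (fun z => .atm (ρ z)) t

/- Opening (i ↝ u)t : replace index i by the 0-term u. -/
mutual
def Trm.opn : {n : ℕ} → Fin (n+1) → Trm S 0 → Trm S (n+1) → Trm S n
  | n, i, u, .idx j =>
      match finSuccEquiv' i j with
      | none => Trm.weaken (Nat.zero_le n) u
      | some k => .idx k
  | _, _, _, .atm x => .atm x
  | _, i, u, .op o as => .op o (Args.opn i u as)
def Args.opn : {n : ℕ} → {ms : List ℕ} → Fin (n+1) → Trm S 0 → Args S (n+1) ms → Args S n ms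
  | _, _, _, _, .nil => .nil
  | _, _, i, u, .cons (m := k) t ts => .cons (Trm.opn (Fin.natAdd k i) u t) (Args.opn i u ts)
end

/- Concretion t[u] of a (1+n)-term at a 0-term. -/
def Trm.conc {n : ℕ} (t : Trm S (n+1)) (u : Trm S 0) : Trm S n := Trm.opn 0 u t

/- Closing (i ↜ x)t : replace the atom x by the index i. -/
mutual
def Trm.cls : {n : ℕ} → Fin (n+1) → ℕ → Trm S n → Trm S (n+1)
  | _, i, _, .idx j => .idx (i.succAbove j)
  | _, i, x, .atm y => if x = y then .idx i else .atm y
  | _, i, x, .op o as => .op o (Args.cls i x as)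
def Args.cls : {n : ℕ} → {ms : List ℕ} → Fin (n+1) → ℕ → Args S n ms → Args S (n+1) ms
  | _, _, _, _, .nil => .nil
  | _, _, i, x, .cons (m := k) t ts => .cons (Trm.cls (Fin.natAdd k i) x t) (Args.cls i x ts)
end

/- Abstraction ⟨x⟩t. -/
def Trm.abs (x : ℕ) {n : ℕ} (t : Trm S n) : Trm S (n+1) := Trm.cls 0 x t

/- Size of a term. -/
mutual
def Trm.size : {n : ℕ} → Trm S n → ℕ
  | _, .idx _ => 0
  | _, .atm _ => 0
  | _, .op _ as => 1 + Args.size as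
def Args.size : {n : ℕ} → {ms : List ℕ} → Args S n ms → ℕ
  | _, _, .nil => 0
  | _, _, .cons t ts => max (Trm.size t) (Args.size ts)
end

/- Nameful terms, argument lists and n-ary bindings over a signature. -/
mutual
inductive NomTrm (S : Sig) : Type where
  | atm : ℕ → NomTrm S
  | op : (o : S.Op) → NomArg S (S.ar o) → NomTrm S
inductive NomArg (S : Sig) : List ℕ → Type where
  | nil : NomArg S []
  | cons : {m : ℕ} → {ms : List ℕ} → NomBind S m → NomArg S ms → NomArg S (m :: ms)
inductive NomBind (S : Sig) : ℕ → Type where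
  | body : NomTrm S → NomBind S 0
  | bind : {m : ℕ} → ℕ → NomBind S m → NomBind S (m+1)
end

/- Support of a nameful term: all atoms occurring, in atom or binding position. -/
mutual
def NomTrm.nsupp : NomTrm S → Finset ℕ
  | .atm x => {x}
  | .op _ bs => NomArg.nsupp bs
def NomArg.nsupp : {ms : List ℕ} → NomArg S ms → Finset ℕ
  | _, .nil => ∅
  | _, .cons b bs => NomBind.nsupp b ∪ NomArg.nsupp bs
def NomBind.nsupp : {m : ℕ} → NomBind S m → Finset ℕ
  | _, .body M => NomTrm.nsupp M
  | _, .bind x b => insert x (NomBind.nsupp b)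
end

/- Renaming of nameful terms: apply ρ to every atom occurrence, including
binding positions. -/
mutual
def NomTrm.rename (ρ : ℕ → ℕ) : NomTrm S → NomTrm S
  | .atm x => .atm (ρ x)
  | .op o bs => .op o (NomArg.rename ρ bs)
def NomArg.rename (ρ : ℕ → ℕ) : {ms : List ℕ} → NomArg S ms → NomArg S ms
  | _, .nil => .nil
  | _, .cons b bs => .cons (NomBind.rename ρ b) (NomArg.rename ρ bs)
def NomBind.rename (ρ : ℕ → ℕ) : {m : ℕ} → NomBind S m → NomBind S m
  | _, .body M => .body (NomTrm.rename ρ M)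
  | _, .bind x b => .bind (ρ x) (NomBind.rename ρ b)
end

/- The single renaming function sending x to y and fixing all other atoms. -/
def rn1 (x y : ℕ) : ℕ → ℕ := fun z => if x = z then y else z

/- α-equivalence of nameful terms. -/
mutual
inductive AEq {S : Sig} : NomTrm S → NomTrm S → Prop where
  | atm (x : ℕ) : AEq (.atm x) (.atm x)
  | op {o : S.Op} {bs bs' : NomArg S (S.ar o)} :
      AEqArg bs bs' → AEq (.op o bs) (.op o bs')
inductive AEqArg {S : Sig} : {ms : List ℕ} → NomArg S ms → NomArg S ms → Prop where
  | nil : AEqArg .nil .nil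
  | cons {m : ℕ} {ms : List ℕ} {b b' : NomBind S m} {bs bs' : NomArg S ms} :
      AEqBind b b' → AEqArg bs bs' → AEqArg (.cons b bs) (.cons b' bs')
inductive AEqBind {S : Sig} : {m : ℕ} → NomBind S m → NomBind S m → Prop where
  | body {M M' : NomTrm S} : AEq M M' → AEqBind (.body M) (.body M')
  | bind {m : ℕ} {x x' y : ℕ} {b b' : NomBind S m} :
      y ∉ NomBind.nsupp b → y ∉ NomBind.nsupp b' →
      AEqBind (NomBind.rename (rn1 x y) b) (NomBind.rename (rn1 x' y) b') →
      AEqBind (.bind x b) (.bind x' b')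
end

/- Translation of nameful terms into well-scoped locally nameless terms;
bindings translate to iterated abstractions. -/
mutual
def NomTrm.transl : NomTrm S → Trm S 0
  | .atm x => .atm x
  | .op o bs => .op o (NomArg.transl bs)
def NomArg.transl : {ms : List ℕ} → NomArg S ms → Args S 0 ms
  | _, .nil => .nil
  | _, .cons b bs => .cons (NomBind.transl b) (NomArg.transl bs)
def NomBind.transl : {m : ℕ} → NomBind S m → Trm S m
  | _, .body M => NomTrm.transl M
  | _, .bind x b => Trm.cls 0 x (NomBind.transl b)
end

/- A chosen atom not in a given finite set (one more than its maximum). -/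
def newAtom (s : Finset ℕ) : ℕ := s.sup id + 1

/- Capture-avoiding substitution of nameful terms for atoms. -/
mutual
def NomTrm.nsubst (σ : ℕ → NomTrm S) : NomTrm S → NomTrm S
  | .atm x => σ x
  | .op o bs => .op o (NomArg.nsubst σ bs)
def NomArg.nsubst (σ : ℕ → NomTrm S) : {ms : List ℕ} → NomArg S ms → NomArg S ms
  | _, .nil => .nil
  | _, .cons b bs => .cons (NomBind.nsubst σ b) (NomArg.nsubst σ bs)
def NomBind.nsubst (σ : ℕ → NomTrm S) : {m : ℕ} → NomBind S m → NomBind S m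
  | _, .body M => .body (NomTrm.nsubst σ M)
  | _, .bind x b =>
      let y := newAtom ((NomBind.nsupp b).biUnion (fun z => NomTrm.nsupp (σ z)))
      .bind y (NomBind.nsubst (fun z => if x = z then .atm y else σ z) b)
end

mutual
theorem Trm.subst_atm_cls (ρ : ℕ → ℕ) (x : ℕ) : {n : ℕ} → (i : Fin (n + 1)) → (t : Trm S n) →
    (∀ y ∈ t.supp, ρ x = ρ y → x = y) →
    Trm.subst (fun z => .atm (ρ z)) (Trm.cls i x t) =
      Trm.cls i (ρ x) (Trm.subst (fun z => .atm (ρ z)) t)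
  | _, _, .idx _, _ => by simp only [Trm.cls, Trm.subst]
  | _, _, .atm y, h => by
      have hy : ρ x = ρ y ↔ x = y := ⟨h y (by simp [Trm.supp]), congrArg ρ⟩
      simp only [Trm.cls, Trm.subst, Trm.weaken, hy]
      split <;> simp only [Trm.subst, Trm.weaken]
  | _, i, .op _ as, h => by
      simp only [Trm.cls, Trm.subst]
      rw [Args.subst_atm_cls ρ x i as (by simpa only [Trm.supp] using h)]
theorem Args.subst_atm_cls (ρ : ℕ → ℕ) (x : ℕ) : {n : ℕ} → {ms : List ℕ} → (i : Fin (n + 1)) →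
    (as : Args S n ms) → (∀ y ∈ as.supp, ρ x = ρ y → x = y) →
    Args.subst (fun z => .atm (ρ z)) (Args.cls i x as) =
      Args.cls i (ρ x) (Args.subst (fun z => .atm (ρ z)) as)
  | _, _, _, .nil, _ => by simp only [Args.cls, Args.subst]
  | _, _, i, .cons t ts, h => by
      simp only [Args.supp, Finset.mem_union] at h
      simp only [Args.cls, Args.subst]
      congr 1
      · exact Trm.subst_atm_cls ρ x _ t fun y hy => h y (.inl hy)
      · exact Args.subst_atm_cls ρ x i ts fun y hy => h y (.inr hy)
end

mutual
theorem Trm.supp_cls_subset (x : ℕ) : {n : ℕ} → (i : Fin (n + 1)) → (t : Trm S n) →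
    (Trm.cls i x t).supp ⊆ t.supp
  | _, _, .idx _ => by simp [Trm.cls, Trm.supp]
  | _, _, .atm y => by
      simp only [Trm.cls]
      split <;> simp [Trm.supp]
  | _, i, .op _ as => by
      simpa only [Trm.cls, Trm.supp] using Args.supp_cls_subset x i as
theorem Args.supp_cls_subset (x : ℕ) : {n : ℕ} → {ms : List ℕ} → (i : Fin (n + 1)) →
    (as : Args S n ms) → (Args.cls i x as).supp ⊆ as.supp
  | _, _, _, .nil => by simp [Args.cls, Args.supp]
  | _, _, i, .cons t ts => by
      simp only [Args.cls, Args.supp]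
      exact Finset.union_subset_union (Trm.supp_cls_subset x _ t)
        (Args.supp_cls_subset x i ts)
end

mutual
theorem NomTrm.supp_transl_subset : (M : NomTrm S) → M.transl.supp ⊆ M.nsupp
  | .atm _ => by simp [NomTrm.transl, NomTrm.nsupp, Trm.supp]
  | .op _ bs => by
      simpa only [NomTrm.transl, NomTrm.nsupp, Trm.supp] using NomArg.supp_transl_subset bs
theorem NomArg.supp_transl_subset : {ms : List ℕ} → (bs : NomArg S ms) →
    bs.transl.supp ⊆ bs.nsupp
  | _, .nil => by simp [NomArg.transl, Args.supp]
  | _, .cons b bs => by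
      simp only [NomArg.transl, NomArg.nsupp, Args.supp]
      exact Finset.union_subset_union (NomBind.supp_transl_subset b)
        (NomArg.supp_transl_subset bs)
theorem NomBind.supp_transl_subset : {m : ℕ} → (b : NomBind S m) → b.transl.supp ⊆ b.nsupp
  | _, .body M => by
      simpa only [NomBind.transl, NomBind.nsupp] using NomTrm.supp_transl_subset M
  | _, .bind x b => by
      simp only [NomBind.transl, NomBind.nsupp]
      exact ((Trm.supp_cls_subset x 0 b.transl).trans (NomBind.supp_transl_subset b)).trans
        (Finset.subset_insert x b.nsupp)
end

mutual
theorem NomTrm.transl_rename_of_injOn (ρ : ℕ → ℕ) : (M : NomTrm S) → Set.InjOn ρ M.nsupp →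
    (NomTrm.rename ρ M).transl = Trm.subst (fun z => .atm (ρ z)) M.transl
  | .atm _, _ => by simp only [NomTrm.rename, NomTrm.transl, Trm.subst, Trm.weaken]
  | .op _ bs, h => by
      simp only [NomTrm.rename, NomTrm.transl, Trm.subst]
      rw [NomArg.transl_rename_of_injOn ρ bs (by simpa only [NomTrm.nsupp] using h)]
theorem NomArg.transl_rename_of_injOn (ρ : ℕ → ℕ) : {ms : List ℕ} → (bs : NomArg S ms) →
    Set.InjOn ρ bs.nsupp →
    (NomArg.rename ρ bs).transl = Args.subst (fun z => .atm (ρ z)) bs.transl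
  | _, .nil, _ => by simp only [NomArg.rename, NomArg.transl, Args.subst]
  | _, .cons b bs, h => by
      simp only [NomArg.nsupp, Finset.coe_union] at h
      simp only [NomArg.rename, NomArg.transl, Args.subst]
      congr 1
      · exact NomBind.transl_rename_of_injOn ρ b (h.mono Set.subset_union_left)
      · exact NomArg.transl_rename_of_injOn ρ bs (h.mono Set.subset_union_right)
theorem NomBind.transl_rename_of_injOn (ρ : ℕ → ℕ) : {m : ℕ} → (b : NomBind S m) →
    Set.InjOn ρ b.nsupp →
    (NomBind.rename ρ b).transl = Trm.subst (fun z => .atm (ρ z)) b.transl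
  | _, .body M, h => by
      simp only [NomBind.rename, NomBind.transl]
      exact NomTrm.transl_rename_of_injOn ρ M (by simpa only [NomBind.nsupp] using h)
  | _, .bind x b, h => by
      simp only [NomBind.nsupp, Finset.coe_insert] at h
      simp only [NomBind.rename, NomBind.transl]
      rw [NomBind.transl_rename_of_injOn ρ b (h.mono (Set.subset_insert x _)),
        Trm.subst_atm_cls]
      exact fun y hy => h (Set.mem_insert x _)
        (Set.mem_insert_of_mem x (NomBind.supp_transl_subset b hy))
end

/-- If ρ is injective on supp M then ⟦ρ * M⟧ = ρ * ⟦M⟧. -/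
theorem transl_rename (S : Sig) (M : NomTrm S) (ρ : ℕ → ℕ)
    (h : ∀ x ∈ M.nsupp, ∀ y ∈ M.nsupp, ρ x = ρ y → x = y) :
    (NomTrm.rename ρ M).transl = Trm.rename ρ M.transl := by
  exact NomTrm.transl_rename_of_injOn ρ M fun x hx y hy => h x hx y hy
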